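/- arXiv:1806.00949 — 2 statements merged into one kernel-verified Lean document; each statement's English description precedes it below -/
import Mathlib

section
/- If the Littlestone dimension of $\mathcal{H} \subseteq \{0,1\}^X$ is at least $2^{t+1}-1$, then $\mathcal{H}$ contains $t+2$ thresholds, i.e., there exist $h_0,\ldots,h_{t+1} \in \mathcal{H}$ and $x_0,\ldots,x_t \in X$ such that $h_i(x_j)=1$ if and only if $j \geq i$. -/
/-- `H` shatters some complete mistake tree of depth `d`. -/
def LdimGe {X : Type*} (H : Set (X → Bool)) (d : ℕ) : Prop :=
  ∃ T : List Bool → X, ∀ l : List Bool, l.length = d →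
    ∃ h ∈ H, ∀ n < d, h (T (l.take n)) = l.getD n false

/-- `H` shatters a complete tree of depth `d` all of whose internal nodes are labeled by points
of `S`. -/
def ShattersTreeIn {X : Type*} (S : Set X) : ℕ → Set (X → Bool) → Prop
  | 0, H => H.Nonempty
  | d + 1, H => ∃ x ∈ S, ∀ b : Bool, ShattersTreeIn S d {h ∈ H | h x = b}

namespace ShattersTreeIn

variable {X : Type*} {S : Set X} {d : ℕ} {H K : Set (X → Bool)}

theorem mono (h : ShattersTreeIn S d H) (hHK : H ⊆ K) : ShattersTreeIn S d K := by
  induction d generalizing H K with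
  | zero => exact Set.Nonempty.mono hHK h
  | succ d ih =>
    obtain ⟨x, hx, hb⟩ := h
    exact ⟨x, hx, fun b => ih (hb b) fun _ hf => ⟨hHK hf.1, hf.2⟩⟩

theorem nonempty (h : ShattersTreeIn S d H) : H.Nonempty := by
  induction d generalizing H with
  | zero => exact h
  | succ d ih =>
    obtain ⟨x, -, hb⟩ := h
    exact (ih (hb true)).mono fun _ hf => hf.1

/-- Ramsey property of shattered trees: if the labels are covered by two sets, then one of the two
sets labels a large shattered subtree. -/
theorem or_of_subset_union {A B : Set X} (hS : S ⊆ A ∪ B) (h : ShattersTreeIn S d H) {p q : ℕ}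
    (hpq : p + q ≤ d + 1) : ShattersTreeIn A p H ∨ ShattersTreeIn B q H := by
  induction d generalizing H p q with
  | zero =>
    obtain rfl | rfl : p = 0 ∨ q = 0 := by omega
    · exact .inl h
    · exact .inr h
  | succ d ih =>
    obtain rfl | hp := Nat.eq_zero_or_pos p
    · exact .inl h.nonempty
    obtain rfl | hq := Nat.eq_zero_or_pos q
    · exact .inr h.nonempty
    obtain ⟨p, rfl⟩ := Nat.exists_eq_succ_of_ne_zero hp.ne'
    obtain ⟨q, rfl⟩ := Nat.exists_eq_succ_of_ne_zero hq.ne'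
    obtain ⟨x, hx, hb⟩ := h
    obtain hxA | hxB := hS hx
    · by_cases hA : ∀ b, ShattersTreeIn A p {h ∈ H | h x = b}
      · exact .inl ⟨x, hxA, hA⟩
      · push Not at hA
        obtain ⟨b, hA⟩ := hA
        exact .inr (((ih (hb b) (by omega)).resolve_left hA).mono fun _ hf => hf.1)
    · by_cases hB : ∀ b, ShattersTreeIn B q {h ∈ H | h x = b}
      · exact .inr ⟨x, hxB, hB⟩
      · push Not at hB
        obtain ⟨b, hB⟩ := hB
        exact .inl (((ih (hb b) (by omega)).resolve_right hB).mono fun _ hf => hf.1)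

theorem exists_thresholds {n : ℕ} (hH : ShattersTreeIn S (2 ^ n - 1) H) :
    ∃ (h : Fin (n + 1) → X → Bool) (x : Fin n → X),
      (∀ i, h i ∈ H) ∧ (∀ j, x j ∈ S) ∧ ∀ i j, h i (x j) = true ↔ (i : ℕ) ≤ (j : ℕ) := by
  induction n generalizing S H with
  | zero =>
    obtain ⟨f, hf⟩ := hH.nonempty
    exact ⟨fun _ => f, Fin.elim0, fun _ => hf, fun j => j.elim0, fun _ j => j.elim0⟩
  | succ n ih =>
    obtain ⟨f, hf⟩ := hH.nonempty
    have hpos : 0 < 2 ^ n := by positivity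
    have hpow : 2 ^ n = (2 ^ n - 1) + 1 := by omega
    have hcover : S ⊆ {x ∈ S | f x = true} ∪ {x ∈ S | f x = false} := fun x hx => by
      cases hfx : f x <;> simp [hx, hfx]
    obtain hT | hF := hH.or_of_subset_union hcover (p := 2 ^ n) (q := 2 ^ n)
      (by rw [pow_succ]; omega)
    · rw [hpow] at hT
      obtain ⟨y, hy, hb⟩ := hT
      obtain ⟨h, x, hh, hx, hhx⟩ := ih (hb false)
      refine ⟨Fin.cons f h, Fin.cons y x, Fin.cases hf fun i => (hh i).1,
        Fin.cases hy.1 fun j => (hx j).1, fun i j => ?_⟩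
      cases i using Fin.cases with
      | zero =>
        cases j using Fin.cases with
        | zero => simpa using hy.2
        | succ j => simpa using (hx j).2
      | succ i =>
        cases j using Fin.cases with
        | zero => simpa using (hh i).2
        | succ j => simpa using hhx i j
    · rw [hpow] at hF
      obtain ⟨y, hy, hb⟩ := hF
      obtain ⟨h, x, hh, hx, hhx⟩ := ih (hb true)
      refine ⟨Fin.snoc h f, Fin.snoc x y, fun i => ?_, fun j => ?_, fun i j => ?_⟩
      · cases i using Fin.lastCases with
        | last => simpa using hf
        | cast i => simpa using (hh i).1
      · cases j using Fin.lastCases with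
        | last => simpa using hy.1
        | cast j => simpa using (hx j).1
      · cases i using Fin.lastCases with
        | last =>
          cases j using Fin.lastCases with
          | last => simpa using hy.2
          | cast j => simp [(hx j).2]
        | cast i =>
          cases j using Fin.lastCases with
          | last =>
            have := i.isLt
            simp [(hh i).2]
            omega
          | cast j => simpa using hhx i j

end ShattersTreeIn

theorem LdimGe.shattersTreeIn_univ {X : Type*} {H : Set (X → Bool)} {d : ℕ} (hH : LdimGe H d) :
    ShattersTreeIn Set.univ d H := by
  induction d generalizing H with
  | zero =>
    obtain ⟨T, hT⟩ := hH
    obtain ⟨h, hh, -⟩ := hT [] rfl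
    exact ⟨h, hh⟩
  | succ d ih =>
    obtain ⟨T, hT⟩ := hH
    refine ⟨T [], Set.mem_univ _, fun b => ih ⟨fun l => T (b :: l), fun l hl => ?_⟩⟩
    obtain ⟨h, hh, hpath⟩ := hT (b :: l) (by simp [hl])
    refine ⟨h, ⟨hh, by simpa using hpath 0 (by omega)⟩, fun n hn => ?_⟩
    simpa using hpath (n + 1) (by omega)

theorem ldim_implies_thresholds {X : Type*} (H : Set (X → Bool)) (t : ℕ)
    (hld : LdimGe H (2 ^ (t + 1) - 1)) :
    ∃ (h : Fin (t + 2) → X → Bool) (x : Fin (t + 1) → X),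
      (∀ i, h i ∈ H) ∧
      ∀ (i : Fin (t + 2)) (j : Fin (t + 1)),
        h i (x j) = true ↔ (i : ℕ) ≤ (j : ℕ) := by
  obtain ⟨h, x, hh, -, hhx⟩ := hld.shattersTreeIn_univ.exists_thresholds
  exact ⟨h, x, hh, hhx⟩
end

section
/- If two probability distributions $p,q$ on a countable set $X$ are $(\epsilon,\delta)$-indistinguishable, then for every $k \in \mathbb{N}$ the $k$-fold product distributions $p^k$ and $q^k$ on $X^k$ are $(k\epsilon, k\delta)$-indistinguishable. -/
/-- Probability of the event `E` under the probability mass function `p`. -/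
noncomputable def massProb {α : Type*} (p : α → ℝ) (E : Set α) : ℝ :=
  ∑' a, Set.indicator E p a

/-- `p` is a probability mass function. -/
def IsProbMass {α : Type*} (p : α → ℝ) : Prop :=
  (∀ a, 0 ≤ p a) ∧ HasSum p 1

/-- `(ε,δ)`-indistinguishability of two distributions. -/
def Indist {α : Type*} (p q : α → ℝ) (ε δ : ℝ) : Prop :=
  ∀ E : Set α,
    massProb p E ≤ Real.exp ε * massProb q E + δ ∧
    massProb q E ≤ Real.exp ε * massProb p E + δ

namespace IsProbMass

variable {α β : Type*} {p : α → ℝ} {r : β → ℝ}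

theorem summable_indicator (hp : IsProbMass p) (E : Set α) : Summable (E.indicator p) :=
  hp.2.summable.indicator E

theorem massProb_nonneg (hp : IsProbMass p) (E : Set α) : 0 ≤ massProb p E :=
  tsum_nonneg fun _ => Set.indicator_nonneg (fun a _ => hp.1 a) _

theorem massProb_le_one (hp : IsProbMass p) (E : Set α) : massProb p E ≤ 1 := by
  rw [← hp.2.tsum_eq]
  exact (hp.summable_indicator E).tsum_le_tsum
    (fun a => Set.indicator_le_self' (fun _ _ => hp.1 a) a) hp.2.summable

theorem summable_mul (hp : IsProbMass p) {f : α → ℝ} (hf0 : ∀ a, 0 ≤ f a)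
    (hf1 : ∀ a, f a ≤ 1) : Summable fun a => p a * f a :=
  Summable.of_nonneg_of_le (fun a => mul_nonneg (hp.1 a) (hf0 a))
    (fun a => mul_le_of_le_one_right (hp.1 a) (hf1 a)) hp.2.summable

theorem prod (hp : IsProbMass p) (hr : IsProbMass r) :
    IsProbMass fun x : α × β => p x.1 * r x.2 := by
  refine ⟨fun x => mul_nonneg (hp.1 _) (hr.1 _), ?_⟩
  simpa using hp.2.mul hr.2 (hp.2.summable.mul_of_nonneg hr.2.summable hp.1 hr.1)

theorem massProb_prod (hp : IsProbMass p) (hr : IsProbMass r) (E : Set (α × β)) :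
    massProb (fun x : α × β => p x.1 * r x.2) E =
      ∑' a, p a * massProb r {b | (a, b) ∈ E} := by
  unfold massProb
  rw [((hp.prod hr).summable_indicator E).tsum_prod]
  refine tsum_congr fun a => ?_
  rw [← tsum_mul_left]
  refine tsum_congr fun b => ?_
  by_cases hb : (a, b) ∈ E <;> simp [Set.indicator, hb]

end IsProbMass

theorem massProb_comp_equiv {α β : Type*} (e : α ≃ β) (p : β → ℝ) (E : Set α) :
    massProb (p ∘ e) E = massProb p (e.symm ⁻¹' E) := by
  unfold massProb
  rw [← e.tsum_eq]
  refine tsum_congr fun a => ?_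
  by_cases ha : a ∈ E <;> simp [Set.indicator, ha]

/-- A bound on all events extends to all `[0, 1]`-valued test functions. -/
theorem tsum_mul_le_of_massProb_le {α : Type*} {p q : α → ℝ} {c δ : ℝ}
    (hp : IsProbMass p) (hq : IsProbMass q)
    (h : ∀ E, massProb p E ≤ c * massProb q E + δ) {f : α → ℝ}
    (hf0 : ∀ a, 0 ≤ f a) (hf1 : ∀ a, f a ≤ 1) :
    ∑' a, p a * f a ≤ c * ∑' a, q a * f a + δ := by
  set E : Set α := {a | c * q a ≤ p a} with hE
  have key : ∑' a, p a * f a - c * ∑' a, q a * f a ≤ massProb p E - c * massProb q E := by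
    unfold massProb
    have sp := hp.summable_mul hf0 hf1
    have sq := (hq.summable_mul hf0 hf1).mul_left c
    have tp := hp.summable_indicator E
    have tq := (hq.summable_indicator E).mul_left c
    rw [← tsum_mul_left, ← tsum_mul_left, ← sp.tsum_sub sq, ← tp.tsum_sub tq]
    refine (sp.sub sq).tsum_le_tsum (fun a => ?_) (tp.sub tq)
    by_cases ha : a ∈ E
    · rw [Set.indicator_of_mem ha, Set.indicator_of_mem ha]
      have ha' : c * q a ≤ p a := ha
      nlinarith [hf1 a]
    · rw [Set.indicator_of_notMem ha, Set.indicator_of_notMem ha]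
      have ha' : p a < c * q a := not_le.mp ha
      nlinarith [hf0 a]
  linarith [h E]

theorem massProb_prod_le {α β : Type*} {p q : α → ℝ} {r s : β → ℝ} {c d δ η : ℝ}
    (hp : IsProbMass p) (hq : IsProbMass q) (hr : IsProbMass r) (hs : IsProbMass s)
    (hc : 0 ≤ c) (hd : 0 ≤ d)
    (hpq : ∀ E, massProb p E ≤ c * massProb q E + δ)
    (hrs : ∀ E, massProb r E ≤ d * massProb s E + η) (E : Set (α × β)) :
    massProb (fun x : α × β => p x.1 * r x.2) E ≤
      c * d * massProb (fun x : α × β => q x.1 * s x.2) E + (δ + η) := by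
  rw [hp.massProb_prod hr, hq.massProb_prod hs]
  have hη : 0 ≤ η := by simpa [massProb] using hrs ∅
  set R : α → ℝ := fun a => massProb r {b | (a, b) ∈ E}
  set S : α → ℝ := fun a => massProb s {b | (a, b) ∈ E}
  have hS0 : ∀ a, 0 ≤ S a := fun a => hs.massProb_nonneg _
  have hS1 : ∀ a, S a ≤ 1 := fun a => hs.massProb_le_one _
  set f : α → ℝ := fun a => min 1 (d * S a)
  have hf0 : ∀ a, 0 ≤ f a := fun a => le_min zero_le_one (mul_nonneg hd (hS0 a))
  have hf1 : ∀ a, f a ≤ 1 := fun a => min_le_left _ _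
  have hR : ∀ a, R a ≤ f a + η := fun a => by
    rw [← min_add_add_right]
    exact le_min (by linarith [hr.massProb_le_one {b | (a, b) ∈ E}]) (hrs _)
  have hpf := hp.summable_mul hf0 hf1
  have hqf := hq.summable_mul hf0 hf1
  have h₁ : ∑' a, p a * R a ≤ ∑' a, p a * f a + η := by
    have hη' := hp.2.mul_right η
    rw [one_mul] at hη'
    rw [← hη'.tsum_eq, ← hpf.tsum_add hη'.summable]
    refine (hp.summable_mul (fun a => hr.massProb_nonneg _)
      (fun a => hr.massProb_le_one _)).tsum_le_tsum (fun a => ?_) (hpf.add hη'.summable)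
    rw [← mul_add]
    exact mul_le_mul_of_nonneg_left (hR a) (hp.1 a)
  have h₂ : ∑' a, q a * f a ≤ d * ∑' a, q a * S a := by
    rw [← tsum_mul_left]
    refine hqf.tsum_le_tsum (fun a => ?_) ((hq.summable_mul hS0 hS1).mul_left d)
    rw [mul_left_comm]
    exact mul_le_mul_of_nonneg_left (min_le_right _ _) (hq.1 a)
  have h₃ := tsum_mul_le_of_massProb_le hp hq hpq hf0 hf1
  have h₄ := mul_le_mul_of_nonneg_left h₂ hc
  rw [mul_assoc]
  linarith

theorem Indist.prod {α β : Type*} {p q : α → ℝ} {r s : β → ℝ} {ε ε' δ δ' : ℝ}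
    (hp : IsProbMass p) (hq : IsProbMass q) (hr : IsProbMass r) (hs : IsProbMass s)
    (hpq : Indist p q ε δ) (hrs : Indist r s ε' δ') :
    Indist (fun x : α × β => p x.1 * r x.2) (fun x => q x.1 * s x.2)
      (ε + ε') (δ + δ') := by
  intro E
  rw [Real.exp_add]
  exact ⟨massProb_prod_le hp hq hr hs (Real.exp_pos _).le (Real.exp_pos _).le
      (fun F => (hpq F).1) (fun F => (hrs F).1) E,
    massProb_prod_le hq hp hs hr (Real.exp_pos _).le (Real.exp_pos _).le
      (fun F => (hpq F).2) (fun F => (hrs F).2) E⟩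

theorem Indist.comp_equiv {α β : Type*} {p q : β → ℝ} {ε δ : ℝ} (h : Indist p q ε δ)
    (e : α ≃ β) : Indist (p ∘ e) (q ∘ e) ε δ := by
  intro E
  rw [massProb_comp_equiv, massProb_comp_equiv]
  exact h _

theorem prod_fin_succ_eq_comp_consEquiv_symm {X : Type*} (p : X → ℝ) (k : ℕ) :
    (fun v : Fin (k + 1) → X => ∏ i, p (v i)) =
      (fun x : X × (Fin k → X) => p x.1 * ∏ i, p (x.2 i)) ∘
        (Fin.consEquiv fun _ : Fin (k + 1) => X).symm := by
  funext v
  simp [Fin.prod_univ_succ, Fin.consEquiv, Fin.tail]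

theorem IsProbMass.pi {X : Type*} {p : X → ℝ} (hp : IsProbMass p) (k : ℕ) :
    IsProbMass fun v : Fin k → X => ∏ i, p (v i) := by
  refine ⟨fun v => Finset.prod_nonneg fun i _ => hp.1 _, ?_⟩
  induction k with
  | zero => simp
  | succ k ih =>
    rw [prod_fin_succ_eq_comp_consEquiv_symm, Equiv.hasSum_iff]
    exact (hp.prod ⟨fun v => Finset.prod_nonneg fun i _ => hp.1 _, ih⟩).2

theorem indist_kfold_prod {X : Type*} [Countable X] (p q : X → ℝ) (ε δ : ℝ)
    (hp : IsProbMass p) (hq : IsProbMass q) (h : Indist p q ε δ) (k : ℕ) :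
    Indist (fun v : Fin k → X => ∏ i, p (v i))
      (fun v : Fin k → X => ∏ i, q (v i)) (k * ε) (k * δ) := by
  induction k with
  | zero => intro E; simp
  | succ k ih =>
    rw [prod_fin_succ_eq_comp_consEquiv_symm, prod_fin_succ_eq_comp_consEquiv_symm]
    convert (h.prod hp hq (hp.pi k) (hq.pi k) ih).comp_equiv _ using 1 <;> push_cast <;> ring
end
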